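/- For every infinite regular cardinal κ, there is a function d : [κ⁺⁺]² → κ⁺⁺ such that for all unbounded subsets A and B of κ⁺⁺ and every ς < κ⁺⁺, there are α ∈ A and β ∈ B with α < β and d({α, β}) = ς. -/

import Mathlib

noncomputable section

open Set

/-- The successor cardinal of `mu`, as an ordinal. -/
def sucOrd (mu : Cardinal) : Ordinal := (Order.succ mu).ord

/-- The cofinality of `mu`, as an ordinal. -/
def cofOrd (mu : Cardinal) : Ordinal := (Ordinal.cof mu.ord).ord

/-- `mu` is a singular cardinal: infinite, with cofinality smaller than itself. -/
def IsSingular (mu : Cardinal) : Prop :=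
  Cardinal.aleph0 ≤ mu ∧ Ordinal.cof mu.ord < mu

/-- `C` is unbounded below `lam`. -/
def UnbddIn (C : Set Ordinal) (lam : Ordinal) : Prop :=
  ∀ x < lam, ∃ y ∈ C, x ≤ y ∧ y < lam

/-- `C` is closed below `lam`: any accumulation point below `lam` belongs to `C`. -/
def ClosedIn (C : Set Ordinal) (lam : Ordinal) : Prop :=
  ∀ δ, δ < lam → 0 < δ → (∀ x < δ, ∃ y ∈ C, x < y ∧ y < δ) → δ ∈ C

/-- `C` is a closed unbounded subset of `lam`. -/
def IsClubIn (C : Set Ordinal) (lam : Ordinal) : Prop :=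
  C ⊆ Set.Iio lam ∧ ClosedIn C lam ∧ UnbddIn C lam

/-- `S` is a stationary subset of `lam`: it meets every closed unbounded subset of `lam`. -/
def IsStatIn (S : Set Ordinal) (lam : Ordinal) : Prop :=
  S ⊆ Set.Iio lam ∧ ∀ C, IsClubIn C lam → (S ∩ C).Nonempty

/-- The set of ordinals `t` has cardinality `< kappa`. -/
def CardLT (t : Set Ordinal) (kappa : Cardinal) : Prop :=
  (Cardinal.mk ↥t : Cardinal.{1}) < Cardinal.lift.{1, 0} kappa

/-- `c` witnesses Shelah's principle `pr₁(μ⁺, μ⁺, σ, cf μ)`: for every sequence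
`⟨t_α : α < μ⁺⟩` of pairwise disjoint subsets of `μ⁺`, each of size `< cf μ`, and every
color `ε < σ`, there are `α < β < μ⁺` with `c` constantly `ε` on pairs from `t_α × t_β`. -/
def Pr1With (mu sigma : Cardinal) (c : Ordinal → Ordinal → Ordinal) : Prop :=
  (∀ a b, a < b → b < sucOrd mu → c a b < sigma.ord) ∧
  ∀ t : Ordinal → Set Ordinal,
    (∀ a, a < sucOrd mu → t a ⊆ Set.Iio (sucOrd mu)) →
    (∀ a b, a < sucOrd mu → b < sucOrd mu → a ≠ b → Disjoint (t a) (t b)) →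
    (∀ a, a < sucOrd mu → CardLT (t a) (Ordinal.cof mu.ord)) →
    ∀ ε, ε < sigma.ord →
      ∃ α β, α < β ∧ β < sucOrd mu ∧
        ∀ ξ ∈ t α, ∀ ζ ∈ t β, c (min ξ ζ) (max ξ ζ) = ε

/-- Shelah's principle `pr₁(μ⁺, μ⁺, σ, cf μ)`. -/
def Pr1 (mu sigma : Cardinal) : Prop := ∃ c, Pr1With mu sigma c

/-- `(mus, f)` is a scale for the singular cardinal `mu`. -/
structure IsScale (mu : Cardinal) (mus : Ordinal → Cardinal)
    (f : Ordinal → Ordinal → Ordinal) : Prop where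
  regular : ∀ i, i < cofOrd mu → (mus i).IsRegular
  strictMono : ∀ i j, i < j → j < cofOrd mu → mus i < mus j
  le_mu : ∀ i, i < cofOrd mu → mus i ≤ mu
  unbdd : ∀ θ, θ < mu → ∃ i, i < cofOrd mu ∧ θ < mus i
  cof_lt : Ordinal.cof mu.ord < mus 0
  f_lt : ∀ α, α < sucOrd mu → ∀ i, i < cofOrd mu → f α i < (mus i).ord
  f_mono : ∀ α β, α < β → β < sucOrd mu →
    ∃ i0, i0 < cofOrd mu ∧ ∀ i, i0 ≤ i → i < cofOrd mu → f α i < f β i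
  f_cofinal : ∀ g : Ordinal → Ordinal, (∀ i, i < cofOrd mu → g i < (mus i).ord) →
    ∃ α, α < sucOrd mu ∧ ∃ i0, i0 < cofOrd mu ∧ ∀ i, i0 ≤ i → i < cofOrd mu → g i < f α i

/-- The minimal walk from `b` down to `a` along the C-sequence `e`:
`walk e a b 0 = b` and `walk e a b (n+1) = min (e (walk e a b n) \ a)`,
staying at `a` once it is reached. -/
def walk (e : Ordinal → Set Ordinal) (a b : Ordinal) : ℕ → Ordinal
  | 0 => b
  | n + 1 => if walk e a b n = a then a else sInf (e (walk e a b n) ∩ Set.Ici a)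

/-- `ρ₂(a,b)`: the length of the minimal walk from `b` to `a`, i.e. the least `n`
with `walk e a b n = a`. -/
def rho2 (e : Ordinal → Set Ordinal) (a b : Ordinal) : ℕ :=
  sInf {n : ℕ | walk e a b n = a}

/-- `β_i⁻(a,b)`: zero for `i = 0`, and `sup (e_{β_j(a,b)} ∩ a)` for `i = j+1`. -/
def walkLow (e : Ordinal → Set Ordinal) (a b : Ordinal) : ℕ → Ordinal
  | 0 => 0
  | j + 1 => sSup (e (walk e a b j) ∩ Set.Iio a)

/-- `γ(a,b) = β_{ρ₂(a,b)-1}(a,b)`, the last step before the walk reaches `a`. -/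
def gammaW (e : Ordinal → Set Ordinal) (a b : Ordinal) : Ordinal :=
  walk e a b (rho2 e a b - 1)

/-- `γ⁻(a,b) = max {β_i⁻(a,b) : i < ρ₂(a,b)}`. -/
def gammaMinusW (e : Ordinal → Set Ordinal) (a b : Ordinal) : Ordinal :=
  sSup (walkLow e a b '' {i : ℕ | i < rho2 e a b})

/-- `η(a,b) = max {β_i⁻(a,b) : i ≤ ρ₂(a,b)}`. -/
def etaW (e : Ordinal → Set Ordinal) (a b : Ordinal) : Ordinal :=
  sSup (walkLow e a b '' {i : ℕ | i ≤ rho2 e a b})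

/-- `e` is a C-sequence on `lam`: each `e ξ` is closed unbounded in `ξ`. -/
def IsCSeq (e : Ordinal → Set Ordinal) (lam : Ordinal) : Prop :=
  ∀ ξ, ξ < lam → IsClubIn (e ξ) ξ

/-- `ξ` is an accumulation point of `C`: `ξ = sup (C ∩ ξ) > 0`. -/
def IsAccOf (C : Set Ordinal) (ξ : Ordinal) : Prop :=
  0 < ξ ∧ sSup (C ∩ Set.Iio ξ) = ξ

/-- The non-accumulation points of `C`. -/
def naccOf (C : Set Ordinal) : Set Ordinal :=
  {ξ ∈ C | sSup (C ∩ Set.Iio ξ) < ξ}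

namespace StrongColoring

universe u

open Ordinal Cardinal Order

/-- The ordinal `lam⁺`. -/
abbrev theta (lam : Cardinal.{u}) : Ordinal.{u} := (Order.succ lam).ord

theorem exists_bound {o c : Ordinal.{u}} (ho : o.card < c.cof) {F : Ordinal.{u} → Ordinal.{u}}
    (hF : ∀ ε < o, F ε < c) : ∃ b < c, ∀ ε < o, F ε ≤ b := by
  have hb : BddAbove (F '' Iio o) := ⟨c, by rintro _ ⟨x, hx, rfl⟩; exact (hF x hx).le⟩
  refine ⟨sSup (F '' Iio o), ?_, fun ε hε => le_csSup hb ⟨ε, hε, rfl⟩⟩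
  apply sSup_lt_of_lt_cof
  · refine Cardinal.mk_image_le.trans_lt ?_
    rw [Cardinal.mk_Iio_ordinal, ← Ordinal.lift_cof, Cardinal.lift_lt]
    exact ho
  · rintro _ ⟨x, hx, rfl⟩; exact hF x hx

variable {lam : Cardinal.{u}}

theorem isRegular_theta (hl : lam.IsRegular) : (Order.succ lam).IsRegular :=
  isRegular_succ hl.aleph0_le

theorem succ_lt_theta (hl : lam.IsRegular) {a : Ordinal} (ha : a < theta lam) :
    a + 1 < theta lam :=
  (isSuccLimit_ord (isRegular_theta hl).aleph0_le).add_one_lt ha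

theorem exists_bound_theta (hl : lam.IsRegular) {o : Ordinal.{u}} (ho : o < theta lam)
    {F : Ordinal.{u} → Ordinal.{u}} (hF : ∀ ε < theta lam, F ε < theta lam) :
    ∃ b < theta lam, ∀ ε ≤ o, F ε ≤ b := by
  have ho' := succ_lt_theta hl ho
  obtain ⟨b, hb, h⟩ := exists_bound (o := o + 1) (c := theta lam) (F := F)
    (by rw [(isRegular_theta hl).cof_ord]; exact lt_ord.1 ho')
    (fun ε hε => hF ε (hε.trans ho'))
  exact ⟨b, hb, fun ε hε => h ε (Order.lt_add_one_iff.2 hε)⟩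

/-- `F` maps `lam⁺` to itself. -/
def SelfMap (lam : Cardinal.{u}) (F : Ordinal.{u} → Ordinal.{u}) : Prop :=
  ∀ ε < theta lam, F ε < theta lam

/-- `T` contains a closure point below `lam⁺` of each self-map of `lam⁺`,
i.e. `T` is stationary in `lam⁺`. -/
def Stat (lam : Cardinal.{u}) (T : Set Ordinal.{u}) : Prop :=
  ∀ F, SelfMap lam F → ∃ δ ∈ T, δ < theta lam ∧ ∀ ε < δ, F ε < δ

theorem Stat.mono {T T' : Set Ordinal.{u}} (h : Stat lam T) (hT : T ⊆ T') : Stat lam T' := by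
  intro F hF
  obtain ⟨δ, hδ, h⟩ := h F hF
  exact ⟨δ, hT hδ, h⟩

theorem Stat.inter_closed {T : Set Ordinal.{u}} (h : Stat lam T) {F : Ordinal.{u} → Ordinal.{u}}
    (hF : SelfMap lam F) : Stat lam {δ ∈ T | δ < theta lam ∧ ∀ ε < δ, F ε < δ} := by
  intro G hG
  obtain ⟨δ, hδ, hδ', hc⟩ := h (fun ε => max (F ε) (G ε)) fun ε hε => max_lt (hF ε hε) (hG ε hε)
  exact ⟨δ, ⟨hδ, hδ', fun ε hε => (le_max_left _ _).trans_lt (hc ε hε)⟩, hδ',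
    fun ε hε => (le_max_right _ _).trans_lt (hc ε hε)⟩

theorem Stat.unbounded {T : Set Ordinal.{u}} (h : Stat lam T)
    (hT : ∀ δ ∈ T, 0 < δ) : ∀ ε < theta lam, ∃ δ ∈ T, δ < theta lam ∧ ε < δ := by
  intro ε hε
  obtain ⟨δ, hδ, hδ', hc⟩ := h (fun _ => ε) (fun _ _ => hε)
  exact ⟨δ, hδ, hδ', hc 0 (hT δ hδ)⟩

theorem Stat.fodor (hl : lam.IsRegular) {T : Set Ordinal.{u}} (h : Stat lam T)
    {r : Ordinal.{u} → Ordinal.{u}} (hr : ∀ δ ∈ T, r δ < δ) :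
    ∃ ν < theta lam, Stat lam {δ ∈ T | r δ = ν} := by
  by_contra! H
  have : ∀ ν, ∃ F, SelfMap lam F ∧ (ν < theta lam → ∀ δ ∈ T, r δ = ν → δ < theta lam →
      ∃ ε < δ, δ ≤ F ε) := by
    intro ν
    by_cases hν : ν < theta lam
    · have := H ν hν
      simp only [Stat, not_forall] at this
      obtain ⟨F, hF, h'⟩ := this
      refine ⟨F, hF, fun _ δ hδ hδ' hlt => ?_⟩
      by_contra! hc
      exact h' ⟨δ, ⟨hδ, hδ'⟩, hlt, hc⟩
    · exact ⟨fun _ => 0, fun _ _ => zero_le.trans_lt (by assumption), fun h => absurd h hν⟩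
  choose F hF hF' using this
  have : ∀ ε, ∃ b, ε < theta lam → b < theta lam ∧ ∀ ν ≤ ε, ∀ ε' ≤ ε, F ν ε' ≤ b := by
    intro ε
    by_cases hε : ε < theta lam
    · have : ∀ ν, ∃ b < theta lam, ∀ ε' ≤ ε, F ν ε' ≤ b :=
        fun ν => exists_bound_theta hl hε (hF ν)
      choose b hb hb' using this
      obtain ⟨c, hc, hc'⟩ := exists_bound_theta hl hε (F := b) (fun ν _ => hb ν)
      exact ⟨c, fun _ => ⟨hc, fun ν hν ε' hε' => (hb' ν ε' hε').trans (hc' ν hν)⟩⟩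
    · exact ⟨0, fun h => absurd h hε⟩
  choose G hG using this
  obtain ⟨δ, hδ, hlt, hc⟩ := h G (fun ε hε => (hG ε hε).1)
  have hrδ := hr δ hδ
  obtain ⟨ε, hε, hle⟩ := hF' (r δ) (hrδ.trans hlt) δ hδ rfl hlt
  have hm : max (r δ) ε < δ := max_lt hrδ hε
  exact absurd (hc _ hm) (not_lt.2 (hle.trans
    ((hG _ (hm.trans hlt)).2 _ (le_max_left _ _) _ (le_max_right _ _))))

/-- Pressing down for finite sequences. -/
theorem Stat.press (hl : lam.IsRegular) {T : Set Ordinal.{u}} (h : Stat lam T)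
    (hT : ∀ δ ∈ T, ω ≤ δ) {r : Ordinal.{u} → List Ordinal.{u}}
    (hr : ∀ δ ∈ T, ∀ x ∈ r δ, x < δ) :
    ∃ L, Stat lam {δ ∈ T | r δ = L} := by
  obtain ⟨ν, -, hν⟩ := h.fodor hl (r := fun δ => ((r δ).length : Ordinal))
    (fun δ hδ => (natCast_lt_omega0 _).trans_le (hT δ hδ))
  have key : ∀ n : ℕ, ∀ (T : Set Ordinal.{u}) (r : Ordinal.{u} → List Ordinal.{u}), Stat lam T →
      (∀ δ ∈ T, ∀ x ∈ r δ, x < δ) → (∀ δ ∈ T, (r δ).length = n) →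
      ∃ L, Stat lam {δ ∈ T | r δ = L} := by
    intro n
    induction n with
    | zero =>
      intro T r h _ hn
      exact ⟨[], h.mono fun δ hδ => ⟨hδ, List.length_eq_zero_iff.1 (hn δ hδ)⟩⟩
    | succ n ih =>
      intro T r h hr hn
      have hcons : ∀ δ ∈ T, r δ = (r δ).headD 0 :: (r δ).tail := by
        intro δ hδ
        have := hn δ hδ
        cases hx : r δ <;> simp_all
      obtain ⟨a, -, ha⟩ := h.fodor hl (r := fun δ => (r δ).headD 0) (fun δ hδ => hr δ hδ _
        (by rw [hcons δ hδ]; simp))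
      obtain ⟨L, hL⟩ := ih _ (fun δ => (r δ).tail) ha
        (fun δ hδ x hx => hr δ hδ.1 x (List.mem_of_mem_tail hx))
        (fun δ hδ => by simp [hn δ hδ.1])
      refine ⟨a :: L, hL.mono fun δ hδ => ⟨hδ.1.1, ?_⟩⟩
      rw [hcons δ hδ.1.1, ← hδ.1.2, ← hδ.2]
  obtain ⟨δ₀, hδ₀, -⟩ := hν (fun _ => 0) (fun ε hε => zero_le.trans_lt hε)
  obtain ⟨L, hL⟩ := key (r δ₀).length _ r hν (fun δ hδ => hr δ hδ.1)
    (fun δ hδ => by exact_mod_cast hδ.2.trans hδ₀.2.symm)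
  exact ⟨L, hL.mono fun δ hδ => ⟨hδ.1.1, hδ.2⟩⟩

/-- The ordinals below `lam⁺` of cofinality `lam`. -/
def cofSet (lam : Cardinal.{u}) : Set Ordinal.{u} := {δ | δ < theta lam ∧ δ.cof = lam}

theorem isSuccLimit_of_mem_cofSet (hl : lam.IsRegular) {δ : Ordinal} (h : δ ∈ cofSet lam) :
    IsSuccLimit δ :=
  Ordinal.one_lt_cof_iff.1 (h.2 ▸ one_lt_aleph0.trans_le hl.aleph0_le)

theorem pos_of_mem_cofSet (hl : lam.IsRegular) {δ : Ordinal} (h : δ ∈ cofSet lam) : 0 < δ :=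
  (isSuccLimit_of_mem_cofSet hl h).bot_lt

theorem omega_le_of_mem_cofSet (hl : lam.IsRegular) {δ : Ordinal} (h : δ ∈ cofSet lam) : ω ≤ δ :=
  Ordinal.omega0_le_of_isSuccLimit (isSuccLimit_of_mem_cofSet hl h)

theorem lt_theta_of_le_ord {a : Ordinal.{u}} (ha : a ≤ lam.ord) :
    a < theta lam :=
  ha.trans_lt (ord_lt_ord.2 (Order.lt_succ lam))

theorem stat_cofSet (hl : lam.IsRegular) (hl' : ℵ₀ < lam) : Stat lam (cofSet lam) := by
  intro F hF
  have : ∀ y, ∃ b, y < theta lam → b < theta lam ∧ ∀ ε ≤ y, F ε < b := by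
    intro y
    by_cases hy : y < theta lam
    · obtain ⟨b, hb, h⟩ := exists_bound_theta hl hy hF
      exact ⟨b + 1, fun _ => ⟨succ_lt_theta hl hb, fun ε hε => Order.lt_add_one_iff.2 (h ε hε)⟩⟩
    · exact ⟨0, fun h => absurd h hy⟩
  choose G hG using this
  have hθ := isRegular_theta hl
  have hne : Order.succ lam ≠ ℵ₀ := (hl'.trans (Order.lt_succ lam)).ne'
  have hGθ : ∀ i < theta lam, G i < theta lam := fun i hi => (hG i hi).1
  have hD : ∀ i < theta lam, deriv G i < theta lam := fun i hi => deriv_lt_ord hθ hne hGθ hi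
  have hN := isNormal_deriv G
  have hlim : IsSuccLimit lam.ord := isSuccLimit_ord hl.aleph0_le
  have hlo := lt_theta_of_le_ord (le_refl lam.ord)
  refine ⟨deriv G lam.ord, ⟨hD _ hlo, ?_⟩, hD _ hlo, ?_⟩
  · rw [cof_map_of_isNormal hN hlim, hl.cof_ord]
  · intro ε hε
    obtain ⟨i, hi, hεi⟩ := (hN.lt_iff_exists_lt hlim).1 hε
    have hεi' := hεi.trans (hN.strictMono (lt_add_one i))
    refine lt_trans ?_ (hN.strictMono (hlim.add_one_lt hi))
    rw [deriv_add_one, lt_nfp_iff] at hεi' ⊢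
    obtain ⟨n, hn⟩ := hεi'
    refine ⟨n + 1, ?_⟩
    rw [Function.iterate_succ_apply']
    have hit : ∀ n, G^[n] (deriv G i + 1) < theta lam := by
      intro n
      induction n with
      | zero => exact succ_lt_theta hl (hD _ (hi.trans hlo))
      | succ n ih => rw [Function.iterate_succ_apply']; exact hGθ _ ih
    exact (hG _ (hit n)).2 _ hn.le

theorem exists_injOn_of_mk_le {s t : Set Ordinal.{u}} (h : #s ≤ #t) :
    ∃ f : Ordinal.{u} → Ordinal.{u}, MapsTo f s t ∧ InjOn f s := by
  classical
  obtain ⟨e⟩ := h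
  refine ⟨fun α => if h : α ∈ s then (e ⟨α, h⟩ : Ordinal) else 0, fun α hα => ?_,
    fun α hα α' hα' h => ?_⟩
  · simp only [dif_pos hα]
    exact (e ⟨α, hα⟩).2
  · simp only [dif_pos hα, dif_pos hα'] at h
    exact congrArg Subtype.val (e.injective (Subtype.ext h))

theorem exists_injections (lam : Cardinal.{u}) :
    ∃ i : Ordinal.{u} → Ordinal.{u} → Ordinal.{u}, ∀ β < theta lam,
    (∀ α < β, i β α < lam.ord) ∧ InjOn (i β) (Iio β) := by
  have : ∀ β, ∃ f : Ordinal.{u} → Ordinal.{u}, β < theta lam →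
      (∀ α < β, f α < lam.ord) ∧ InjOn f (Iio β) := by
    intro β
    by_cases hβ : β < theta lam
    · have : #(Iio β) ≤ #(Iio lam.ord) := by
        rw [Cardinal.mk_Iio_ordinal, Cardinal.mk_Iio_ordinal, Cardinal.lift_le, card_ord]
        exact Order.lt_succ_iff.1 (lt_ord.1 hβ)
      obtain ⟨f, hf, hf'⟩ := exists_injOn_of_mk_le this
      exact ⟨f, fun _ => ⟨hf, hf'⟩⟩
    · exact ⟨id, fun h => absurd h hβ⟩
  choose f hf using this
  exact ⟨f, hf⟩

theorem exists_injOn_of_unbounded (hl : lam.IsRegular) {H : Set Ordinal.{u}}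
    (hH : ∀ ε < theta lam, ∃ δ ∈ H, δ < theta lam ∧ ε < δ) :
    ∃ j : Ordinal.{u} → Ordinal.{u}, (∀ ς < theta lam, j ς ∈ H) ∧ InjOn j (Iio (theta lam)) := by
  have : #(Iio (theta lam)) ≤ #(H ∩ Iio (theta lam) : Set Ordinal.{u}) := by
    by_contra! hlt
    rw [Cardinal.mk_Iio_ordinal, card_ord, ← (isRegular_theta hl).cof_ord, Ordinal.lift_cof] at hlt
    have hs := sSup_lt_of_lt_cof hlt (fun i hi => hi.2)
    obtain ⟨δ, hδ, hδ', hlt'⟩ := hH _ hs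
    exact not_le.2 hlt' (le_csSup ⟨theta lam, fun x hx => hx.2.le⟩ ⟨hδ, hδ'⟩)
  obtain ⟨f, hf, hf'⟩ := exists_injOn_of_mk_le this
  exact ⟨f, fun ς hς => (hf hς).1, hf'⟩

theorem Stat.inter_gt {T : Set Ordinal.{u}} (h : Stat lam T) (hT : ∀ δ ∈ T, 0 < δ)
    {b : Ordinal.{u}} (hb : b < theta lam) : Stat lam {δ ∈ T | b < δ} :=
  (h.inter_closed (F := fun _ => b) (fun _ _ => hb)).mono
    fun δ hδ => ⟨hδ.1, hδ.2.2 0 (hT δ hδ.1)⟩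

/-- Ulam's splitting of `cofSet lam` into `lam⁺` stationary sets. -/
theorem exists_splitting (hl : lam.IsRegular) (hl' : ℵ₀ < lam) :
    ∃ h : Ordinal.{u} → Ordinal.{u}, (∀ β, h β < theta lam) ∧
      ∀ ς < theta lam, Stat lam {δ ∈ cofSet lam | h δ = ς} := by
  obtain ⟨i, hi⟩ := exists_injections lam
  have hpos : ∀ δ ∈ cofSet lam, 0 < δ := fun δ => pos_of_mem_cofSet hl
  have hlo := lt_theta_of_le_ord (le_refl lam.ord)
  have hS := stat_cofSet hl hl'
  have hν : ∀ α, ∃ ν < lam.ord, α < theta lam →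
      Stat lam {β ∈ cofSet lam | α < β ∧ i β α = ν} := by
    intro α
    by_cases hα : α < theta lam
    · have h1 := hS.inter_gt hpos (max_lt hα hlo)
      obtain ⟨ν, -, hν⟩ := h1.fodor hl (r := fun β => i β α) (fun β hβ =>
        ((hi β hβ.1.1).1 α ((le_max_left _ _).trans_lt hβ.2)).trans
          ((le_max_right _ _).trans_lt hβ.2))
      obtain ⟨δ₀, hδ₀, -⟩ := hν (fun _ => 0) (fun ε hε => zero_le.trans_lt hε)
      refine ⟨ν, ?_, fun _ => hν.mono fun β hβ =>
        ⟨hβ.1.1, (le_max_left _ _).trans_lt hβ.1.2, hβ.2⟩⟩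
      rw [← hδ₀.2]
      exact (hi δ₀ hδ₀.1.1.1).1 α ((le_max_left _ _).trans_lt hδ₀.1.2)
    · exact ⟨0, hl.ord_pos, fun h => absurd h hα⟩
  choose ν hνlt hν using hν
  obtain ⟨ν₀, -, hν₀⟩ := (hS.inter_gt hpos hlo).fodor hl (r := ν)
    (fun δ hδ => (hνlt δ).trans hδ.2)
  obtain ⟨j, hjmem, hj⟩ := exists_injOn_of_unbounded hl
    (hν₀.unbounded fun δ hδ => hpos δ hδ.1.1)
  classical
  refine ⟨fun β => if h : ∃ ς < theta lam, j ς < β ∧ i β (j ς) = ν₀ then h.choose else 0, ?_, ?_⟩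
  · intro β
    by_cases h : ∃ ς < theta lam, j ς < β ∧ i β (j ς) = ν₀
    · simp only [dif_pos h]; exact h.choose_spec.1
    · simp only [dif_neg h]; exact lt_theta_of_le_ord zero_le
  · intro ς hς
    have hm := hjmem ς hς
    refine (hν (j ς) hm.1.1.1).mono fun β hβ => ⟨hβ.1, ?_⟩
    rw [hm.2] at hβ
    have h : ∃ ς < theta lam, j ς < β ∧ i β (j ς) = ν₀ := ⟨ς, hς, hβ.2⟩
    simp only [dif_pos h]
    exact hj h.choose_spec.1 hς ((hi β hβ.1.1).2 h.choose_spec.2.1 hβ.2.1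
      (h.choose_spec.2.2.trans hβ.2.2.symm))
/-- The data of one step of a minimal walk from `γ` towards `α < γ` along a `C`-sequence:
`g γ α` is the index of the step, `next γ α` its endpoint and `low γ α` the supremum of the
part of the ladder of `γ` lying below `α`. -/
structure Ladder (lam : Cardinal.{u}) where
  g : Ordinal.{u} → Ordinal.{u} → Ordinal.{u}
  next : Ordinal.{u} → Ordinal.{u} → Ordinal.{u}
  low : Ordinal.{u} → Ordinal.{u} → Ordinal.{u}
  le_next {γ α} : α < γ → α ≤ next γ α
  next_lt {γ α} : α < γ → next γ α < γ
  g_lt {γ α} : α < γ → γ < theta lam → g γ α < lam.ord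
  low_le {γ α} : α < γ → low γ α ≤ α
  same {γ δ α} : δ < γ → low γ δ < α → α ≤ δ →
    g γ α = g γ δ ∧ next γ α = next γ δ ∧ low γ α = low γ δ
  low_lt {γ δ} : δ ∈ cofSet lam → δ < γ → γ < theta lam → low γ δ < δ
  low_gt {δ ε} : δ ∈ cofSet lam → ε < δ → ∃ x < δ, ∀ α, x < α → α < δ → ε < low δ α
  g_gt {δ ν} : δ ∈ cofSet lam → ν < lam.ord → ∃ x < δ, ∀ α, x < α → α < δ → ν < g δ α

theorem exists_ladder_seq (γ : Ordinal.{u}) : ∃ s : Ordinal.{u} → Ordinal.{u},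
    (∀ i < γ.cof.ord, s i < γ) ∧ (∀ i j, i < j → j < γ.cof.ord → s i < s j) ∧
      ∀ α < γ, ∃ i < γ.cof.ord, α ≤ s i := by
  classical
  obtain ⟨f, hf⟩ := exists_isFundamentalSeq (o := γ) rfl
  refine ⟨fun i => if h : i ∈ Iio γ.cof.ord then f ⟨i, h⟩ else 0, ?_, ?_, ?_⟩
  · intro i hi
    have hi' : i ∈ Iio γ.cof.ord := hi
    simp only [dif_pos hi']
    exact (f ⟨i, hi⟩).2
  · intro i j hij hj
    have hj' : j ∈ Iio γ.cof.ord := hj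
    have hi' : i ∈ Iio γ.cof.ord := hij.trans hj
    simp only [dif_pos hj', dif_pos hi']
    exact hf.strictMono (show (⟨i, hi'⟩ : Iio γ.cof.ord) < ⟨j, hj'⟩ from hij)
  · intro α hα
    obtain ⟨_, ⟨i, rfl⟩, hi⟩ := hf.isCofinal_range ⟨α, hα⟩
    refine ⟨i, i.2, ?_⟩
    simp only [dif_pos i.2]
    exact hi

theorem exists_ladder (hl : lam.IsRegular) : Nonempty (Ladder lam) := by
  choose s hs hmono hcof using exists_ladder_seq.{u}
  let g : Ordinal.{u} → Ordinal.{u} → Ordinal.{u} :=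
    fun γ α => sInf {i | i < γ.cof.ord ∧ α ≤ s γ i}
  have hg : ∀ {γ α}, α < γ → g γ α < γ.cof.ord ∧ α ≤ s γ (g γ α) := by
    intro γ α h
    obtain ⟨i, hi⟩ := hcof γ α h
    exact csInf_mem (s := {i | i < γ.cof.ord ∧ α ≤ s γ i}) ⟨i, hi⟩
  have hg' : ∀ {γ α i}, α < γ → i < g γ α → s γ i < α := by
    intro γ α i h hi
    by_contra! hc
    exact notMem_of_lt_csInf' hi ⟨hi.trans (hg h).1, hc⟩
  have hgle : ∀ {γ α i}, i < γ.cof.ord → α ≤ s γ i → g γ α ≤ i :=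
    fun h h' => csInf_le' ⟨h, h'⟩
  have hgt : ∀ {γ α i}, α < γ → i < γ.cof.ord → s γ i < α → i < g γ α := by
    intro γ α i h hi hlt
    by_contra! hc
    rcases hc.lt_or_eq with hc | hc
    · exact absurd ((hg h).2.trans (hmono γ _ _ hc hi).le) (not_le.2 hlt)
    · exact absurd (hc ▸ (hg h).2) (not_le.2 hlt)
  have hord : ∀ {γ}, γ < theta lam → γ.cof.ord ≤ lam.ord := by
    intro γ h
    refine ord_le_ord.2 ((cof_le_card γ).trans (Order.lt_succ_iff.1 (lt_ord.1 h)))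
  have hbdd : ∀ {γ α}, α < γ → BddAbove (s γ '' Iio (g γ α)) := by
    intro γ α h
    exact ⟨α, by rintro _ ⟨i, hi, rfl⟩; exact (hg' h hi).le⟩
  refine ⟨{
    g := g
    next := fun γ α => s γ (g γ α)
    low := fun γ α => sSup (s γ '' Iio (g γ α))
    le_next := fun h => (hg h).2
    next_lt := fun h => hs _ _ (hg h).1
    g_lt := fun h h' => (hg h).1.trans_le (hord h')
    low_le := fun h => csSup_le' (by rintro _ ⟨i, hi, rfl⟩; exact (hg' h hi).le)
    same := ?_
    low_lt := ?_
    low_gt := ?_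
    g_gt := ?_ }⟩
  · intro γ δ α hδ hlow hα
    have : g γ α = g γ δ := by
      apply le_antisymm
      · exact hgle (hg hδ).1 (hα.trans (hg hδ).2)
      · by_contra! hc
        exact absurd (hg (hα.trans_lt hδ)).2
          (not_le.2 ((le_csSup (hbdd hδ) ⟨_, hc, rfl⟩).trans_lt hlow))
    simp only [this, and_self]
  · intro γ δ hδ hlt hγ
    obtain ⟨b, hb, h⟩ := exists_bound (o := g γ δ) (c := δ) (F := s γ)
      (by rw [hδ.2]; exact lt_ord.1 ((hg hlt).1.trans_le (hord hγ))) (fun i hi => hg' hlt hi)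
    exact (csSup_le' (by rintro _ ⟨i, hi, rfl⟩; exact h i hi)).trans_lt hb
  · intro δ ε hδ hε
    obtain ⟨i, hi, hεi⟩ := hcof δ ε hε
    have hi' : i + 1 < δ.cof.ord := by
      rw [hδ.2] at hi ⊢
      exact (isSuccLimit_ord hl.aleph0_le).add_one_lt hi
    refine ⟨s δ (i + 1), hs _ _ hi', fun α hα hαδ => ?_⟩
    exact (hεi.trans_lt (hmono δ _ _ (lt_add_one i) hi')).trans_le
      (le_csSup (hbdd hαδ) ⟨_, hgt hαδ hi' hα, rfl⟩)
  · intro δ ν hδ hν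
    rw [← hδ.2] at hν
    exact ⟨s δ ν, hs _ _ hν, fun α hα hαδ => hgt hαδ hν hα⟩

namespace Ladder
variable (D : Ladder lam)

/-- The ordinals visited by the walk from `β` to `α`, except `α` itself. -/
def tr (α β : Ordinal.{u}) : List Ordinal.{u} :=
  if _ : α < β then β :: tr α (D.next β α) else []
termination_by β
decreasing_by exact D.next_lt ‹_›

/-- The running maxima of `m` and the lower bounds met on the walk from `β` to `α`. -/
def lows (m α β : Ordinal.{u}) : List Ordinal.{u} :=
  if _ : α < β then max m (D.low β α) :: lows (max m (D.low β α)) α (D.next β α) else []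
termination_by β
decreasing_by exact D.next_lt ‹_›

/-- The maximum of `m` and of the lower bounds met on the walk from `β` to `α`. -/
def top (m α β : Ordinal.{u}) : Ordinal.{u} :=
  if _ : α < β then top (max m (D.low β α)) α (D.next β α) else m
termination_by β
decreasing_by exact D.next_lt ‹_›

/-- The maximal weight of the walk from `β` to `α`. -/
def rho (α β : Ordinal.{u}) : Ordinal.{u} :=
  if _ : α < β then max (D.g β α) (rho α (D.next β α)) else 0
termination_by β
decreasing_by exact D.next_lt ‹_›

variable {D} {m m' α β δ ν x : Ordinal.{u}}

theorem tr_of_lt (h : α < β) : D.tr α β = β :: D.tr α (D.next β α) := by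
  rw [tr, dif_pos h]

theorem tr_of_le (h : β ≤ α) : D.tr α β = [] := by
  rw [tr, dif_neg (not_lt.2 h)]

theorem lows_of_lt (h : α < β) : D.lows m α β =
    max m (D.low β α) :: D.lows (max m (D.low β α)) α (D.next β α) := by
  rw [lows, dif_pos h]

theorem lows_of_le (h : β ≤ α) : D.lows m α β = [] := by
  rw [lows, dif_neg (not_lt.2 h)]

theorem top_of_lt (h : α < β) : D.top m α β = D.top (max m (D.low β α)) α (D.next β α) := by
  rw [top, dif_pos h]

theorem top_of_le (h : β ≤ α) : D.top m α β = m := by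
  rw [top, dif_neg (not_lt.2 h)]

theorem rho_of_lt (h : α < β) : D.rho α β = max (D.g β α) (D.rho α (D.next β α)) := by
  rw [rho, dif_pos h]

theorem rho_of_le (h : β ≤ α) : D.rho α β = 0 := by
  rw [rho, dif_neg (not_lt.2 h)]

theorem length_lows : (D.lows m α β).length = (D.tr α β).length := by
  induction β using WellFoundedLT.induction generalizing m with
  | ind β ih =>
    rcases lt_or_ge α β with h | h
    · rw [lows_of_lt h, tr_of_lt h, List.length_cons, List.length_cons, ih _ (D.next_lt h)]
    · simp [lows_of_le h, tr_of_le h]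

theorem le_top : m ≤ D.top m α β := by
  induction β using WellFoundedLT.induction generalizing m with
  | ind β ih =>
    rcases lt_or_ge α β with h | h
    · rw [top_of_lt h]; exact (le_max_left _ _).trans (ih _ (D.next_lt h))
    · rw [top_of_le h]

theorem low_le_top (h : α < β) : D.low β α ≤ D.top m α β := by
  rw [top_of_lt h]; exact (le_max_right _ _).trans le_top

theorem start_le_of_mem_lows (hx : x ∈ D.lows m α β) : m ≤ x := by
  induction β using WellFoundedLT.induction generalizing m with
  | ind β ih =>
    rcases lt_or_ge α β with h | h
    · rw [lows_of_lt h, List.mem_cons] at hx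
      rcases hx with rfl | hx
      · exact le_max_left _ _
      · exact (le_max_left _ _).trans (ih _ (D.next_lt h) hx)
    · simp [lows_of_le h] at hx

theorem low_le_of_mem_lows (hx : x ∈ D.lows m α β) : D.low β α ≤ x := by
  rcases lt_or_ge α β with h | h
  · rw [lows_of_lt h, List.mem_cons] at hx
    rcases hx with rfl | hx
    · exact le_max_right _ _
    · exact (le_max_right _ _).trans (start_le_of_mem_lows hx)
  · simp [lows_of_le h] at hx

theorem le_max_of_mem_lows (hx : x ∈ D.lows m α β) : x ≤ max m α := by
  induction β using WellFoundedLT.induction generalizing m with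
  | ind β ih =>
    rcases lt_or_ge α β with h | h
    · have hle := max_le_max_left m (D.low_le h)
      rw [lows_of_lt h, List.mem_cons] at hx
      rcases hx with rfl | hx
      · exact hle
      · exact (ih _ (D.next_lt h) hx).trans (max_le hle (le_max_right _ _))
    · simp [lows_of_le h] at hx

theorem le_top_of_mem_lows (hx : x ∈ D.lows m α β) : x ≤ D.top m α β := by
  induction β using WellFoundedLT.induction generalizing m with
  | ind β ih =>
    rcases lt_or_ge α β with h | h
    · rw [top_of_lt h]
      rw [lows_of_lt h, List.mem_cons] at hx
      rcases hx with rfl | hx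
      · exact le_top
      · exact ih _ (D.next_lt h) hx
    · simp [lows_of_le h] at hx

theorem top_lt (hδ : δ ∈ cofSet lam) (hβ : β < theta lam) (hm : m < δ) :
    D.top m δ β < δ := by
  induction β using WellFoundedLT.induction generalizing m with
  | ind β ih =>
    rcases lt_or_ge δ β with h | h
    · rw [top_of_lt h]
      exact ih _ (D.next_lt h) ((D.next_lt h).trans hβ) (max_lt hm (D.low_lt hδ h hβ))
    · rwa [top_of_le h]

theorem rho_lt (hl : lam.IsRegular) (hβ : β < theta lam) : D.rho α β < lam.ord := by
  induction β using WellFoundedLT.induction with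
  | ind β ih =>
    rcases lt_or_ge α β with h | h
    · rw [rho_of_lt h]
      exact max_lt (D.g_lt h hβ) (ih _ (D.next_lt h) ((D.next_lt h).trans hβ))
    · rw [rho_of_le h]; exact hl.ord_pos

theorem walk_concat (hδβ : δ ≤ β) (htop : D.top m δ β < α) (hα : α < δ) :
    D.tr α β = D.tr δ β ++ D.tr α δ ∧
    D.lows m α β = D.lows m δ β ++ D.lows (D.top m δ β) α δ ∧
    D.rho α β = max (D.rho δ β) (D.rho α δ) := by
  induction β using WellFoundedLT.induction generalizing m with
  | ind β ih =>
    rcases hδβ.lt_or_eq with h | rfl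
    · have hαβ := hα.trans h
      obtain ⟨h1, h2, h3⟩ := D.same h ((low_le_top h).trans_lt htop) hα.le
      rw [top_of_lt h] at htop ⊢
      obtain ⟨i1, i2, i3⟩ := ih _ (D.next_lt h) (D.le_next h) htop
      rw [tr_of_lt hαβ, tr_of_lt h, lows_of_lt hαβ, lows_of_lt h, rho_of_lt hαβ, rho_of_lt h,
        h1, h2, h3, i1, i2, i3, List.cons_append, List.cons_append, max_assoc]
      exact ⟨rfl, rfl, rfl⟩
    · simp [tr_of_le, lows_of_le, top_of_le, rho_of_le]

theorem lows_eq_zero (hα : α < δ) (hm : m ≤ D.low δ α) : D.lows m α δ = D.lows 0 α δ := by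
  rw [lows_of_lt hα, lows_of_lt hα, max_eq_right hm, max_eq_right zero_le]

theorem g_le_rho (h : α < β) : D.g β α ≤ D.rho α β := by
  rw [rho_of_lt h]; exact le_max_left _ _

theorem rho_eventually_eq (hl : lam.IsRegular) (hδ : δ ∈ cofSet lam) (hδβ : δ ≤ β)
    (hβ : β < theta lam) : ∃ ε < δ, ∀ ξ, ε < ξ → ξ < δ → D.rho ξ β = D.rho ξ δ := by
  obtain ⟨x, hx, hg⟩ := D.g_gt hδ (D.rho_lt hl hβ (α := δ))
  refine ⟨max x (D.top 0 δ β), max_lt hx (top_lt hδ hβ (pos_of_mem_cofSet hl hδ)), ?_⟩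
  intro ξ hξ hξδ
  rw [(walk_concat hδβ ((le_max_right _ _).trans_lt hξ) hξδ).2.2]
  exact max_eq_right ((hg ξ ((le_max_left _ _).trans_lt hξ) hξδ).le.trans (g_le_rho hξδ))

theorem rho_eventually_gt (hl : lam.IsRegular) (hδ : δ ∈ cofSet lam) (hδβ : δ ≤ β)
    (hβ : β < theta lam) (hν : ν < lam.ord) : ∃ ε < δ, ∀ ξ, ε < ξ → ξ < δ → ν < D.rho ξ β := by
  obtain ⟨ε, hε, h⟩ := D.rho_eventually_eq hl hδ hδβ hβ
  obtain ⟨x, hx, hg⟩ := D.g_gt hδ hν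
  refine ⟨max ε x, max_lt hε hx, fun ξ hξ hξδ => ?_⟩
  rw [h ξ ((le_max_left _ _).trans_lt hξ) hξδ]
  exact (hg ξ ((le_max_right _ _).trans_lt hξ) hξδ).trans_le (g_le_rho hξδ)

end Ladder

/-- The number of occurrences of `true` immediately followed by `false`. -/
def descents : List Bool → ℕ
  | true :: false :: l => descents (false :: l) + 1
  | _ :: l => descents l
  | [] => 0

theorem descents_append {w : List Bool} (hw : w.getLast? = some false) (t : List Bool) :
    descents (w ++ t) = descents w + descents t := by
  induction w with
  | nil => simp at hw
  | cons a w ih =>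
    cases w with
    | nil =>
      have : a = false := by simpa using hw
      subst this
      simp [descents]
    | cons b w =>
      have := ih (by simpa using hw)
      cases a <;> cases b <;> simp_all [descents]
      omega

theorem descents_replicate (b : Bool) (k : ℕ) : descents (List.replicate k b) = 0 := by
  induction k with
  | zero => rfl
  | succ k ih => cases k <;> cases b <;> simp_all [descents, List.replicate_succ]

theorem descents_true_false {k k' : ℕ} (hk : 0 < k) (hk' : 0 < k') :
    descents (List.replicate k true ++ List.replicate k' false) = 1 := by
  obtain ⟨k', rfl⟩ := Nat.exists_eq_succ_of_ne_zero hk'.ne'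
  induction k with
  | zero => simp at hk
  | succ k ih =>
    cases k with
    | zero =>
      have := descents_replicate false (k' + 1)
      simp_all [descents, List.replicate_succ]
    | succ k =>
      have := ih (by omega)
      simp_all [descents, List.replicate_succ]

theorem exists_list_bound {c : Ordinal.{u}} (hc : 0 < c) {L : List Ordinal.{u}}
    (hL : ∀ x ∈ L, x < c) : ∃ b < c, ∀ x ∈ L, x ≤ b := by
  induction L with
  | nil => exact ⟨0, hc, by simp⟩
  | cons a L ih =>
    obtain ⟨b, hb, h⟩ := ih fun x hx => hL x (List.mem_cons_of_mem _ hx)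
    refine ⟨max a b, max_lt (hL a List.mem_cons_self) hb, fun x hx => ?_⟩
    rcases List.mem_cons.1 hx with rfl | hx
    · exact le_max_left _ _
    · exact (h x hx).trans (le_max_right _ _)

/-- `A` is an unbounded subset of `lam⁺`. -/
def Unb (lam : Cardinal.{u}) (A : Set Ordinal.{u}) : Prop :=
  A ⊆ Iio (theta lam) ∧ ∀ ε < theta lam, ∃ α ∈ A, ε < α

theorem theta_pos : 0 < theta lam := lt_theta_of_le_ord zero_le

theorem Unb.exists_selfMap {A : Set Ordinal.{u}} (hA : Unb lam A) :
    ∃ H, SelfMap lam H ∧ ∀ ε < theta lam, H ε ∈ A ∧ ε < H ε := by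
  have : ∀ ε, ∃ α, ε < theta lam → α ∈ A ∧ ε < α := by
    intro ε
    by_cases hε : ε < theta lam
    · obtain ⟨α, h⟩ := hA.2 ε hε
      exact ⟨α, fun _ => h⟩
    · exact ⟨0, fun h => absurd h hε⟩
  choose H hH using this
  exact ⟨H, fun ε hε => hA.1 (hH ε hε).1, hH⟩

theorem Stat.unb (hl : lam.IsRegular) {T : Set Ordinal.{u}} (hT : Stat lam T)
    (hTS : T ⊆ cofSet lam) : Unb lam T := by
  refine ⟨fun δ hδ => (hTS hδ).1, fun ε hε => ?_⟩
  obtain ⟨δ, h1, -, h2⟩ := hT.unbounded (fun δ hδ => pos_of_mem_cofSet hl (hTS hδ)) ε hε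
  exact ⟨δ, h1, h2⟩

theorem Stat.nonempty {T : Set Ordinal.{u}} (hT : Stat lam T) : ∃ δ, δ ∈ T := by
  obtain ⟨δ, hδ, -⟩ := hT (fun _ => 0) (fun ε hε => zero_le.trans_lt hε)
  exact ⟨δ, hδ⟩

namespace Ladder
variable (D : Ladder lam)

/-- Whether the weight of the walk from `α` to `ξ` exceeds that of the walk from `β` to `ξ`. -/
def sign (α β ξ : Ordinal.{u}) : Bool := decide (D.rho ξ β < D.rho ξ α)

/-- The signs of the pair `α < β` along the lower trace of the walk from `β` to `α`. -/
def word (α β : Ordinal.{u}) : List Bool := (D.lows 0 α β).map (D.sign α β)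

/-- The oscillation number of the pair `α < β`. -/
def osc (α β : Ordinal.{u}) : ℕ := descents (D.word α β)

variable {D}

theorem exists_rho_large (hl : lam.IsRegular) (hl' : ℵ₀ < lam) {A : Set Ordinal.{u}}
    (hA : Unb lam A) : ∃ ε < theta lam, ∀ F : List Ordinal.{u}, (∀ ξ ∈ F, ε < ξ ∧ ξ < theta lam) →
      ∀ ν < lam.ord, ∀ b < theta lam, ∃ α ∈ A, b < α ∧ ∀ ξ ∈ F, ν < D.rho ξ α := by
  by_contra! H
  have : ∀ ε, ∃ (F : List Ordinal.{u}) (ν b : Ordinal.{u}), ν < lam.ord ∧ (ε < theta lam →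
      (∀ ξ ∈ F, ε < ξ ∧ ξ < theta lam) ∧ b < theta lam ∧
      ∀ α ∈ A, b < α → ∃ ξ ∈ F, D.rho ξ α ≤ ν) := by
    intro ε
    by_cases hε : ε < theta lam
    · obtain ⟨F, hF, ν, hν, b, hb, h⟩ := H ε hε
      exact ⟨F, ν, b, hν, fun _ => ⟨hF, hb, h⟩⟩
    · exact ⟨[], 0, 0, hl.ord_pos, fun h => absurd h hε⟩
  choose F ν b hν h using this
  have hM : ∀ ε, ∃ M, ε < theta lam → M < theta lam ∧ b ε ≤ M ∧ ∀ ξ ∈ F ε, ξ ≤ M := by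
    intro ε
    by_cases hε : ε < theta lam
    · obtain ⟨c, hc, hcF⟩ := exists_list_bound theta_pos fun ξ hξ => ((h ε hε).1 ξ hξ).2
      exact ⟨max (b ε) c, fun _ => ⟨max_lt (h ε hε).2.1 hc, le_max_left _ _,
        fun ξ hξ => (hcF ξ hξ).trans (le_max_right _ _)⟩⟩
    · exact ⟨0, fun h => absurd h hε⟩
  choose M hM using hM
  have hS := stat_cofSet hl hl'
  have hpos : ∀ δ ∈ cofSet lam, 0 < δ := fun δ => pos_of_mem_cofSet hl
  obtain ⟨ν₀, -, hT⟩ := (hS.inter_gt hpos (lt_theta_of_le_ord le_rfl)).fodor hl (r := ν)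
    (fun δ hδ => (hν δ).trans hδ.2)
  obtain ⟨δ₀, hδ₀⟩ := hT.nonempty
  have hν₀ : ν₀ < lam.ord := hδ₀.2 ▸ hν δ₀
  obtain ⟨J, hJ, hJ'⟩ := (hT.unb hl fun δ hδ => hδ.1.1).exists_selfMap
  obtain ⟨γ, hγ, hγθ, hγc⟩ := hS (fun ε => max (M ε) (J ε))
    fun ε hε => max_lt (hM ε hε).1 (hJ ε hε)
  obtain ⟨α, hα, hγα⟩ := hA.2 γ hγθ
  obtain ⟨ε, hε, hρ⟩ := D.rho_eventually_gt hl hγ hγα.le (hA.1 hα) hν₀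
  have hεθ := hε.trans hγθ
  have hJε := hJ' ε hεθ
  have hJγ := (le_max_right _ _).trans_lt (hγc ε hε)
  have hJθ := hJγ.trans hγθ
  have hMγ := (le_max_left _ _).trans_lt (hγc _ hJγ)
  obtain ⟨ξ, hξ, hle⟩ := (h _ hJθ).2.2 α hα ((hM _ hJθ).2.1.trans_lt (hMγ.trans hγα))
  rw [hJε.1.2] at hle
  exact absurd (hρ ξ (hJε.2.trans ((h _ hJθ).1 ξ hξ).1) (((hM _ hJθ).2.2 ξ hξ).trans_lt hMγ))
    (not_lt.2 hle)

/-- Stationarily many points of `T` are seen by the ladder of a larger point of `T`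
only above `ε`. -/
theorem stat_low_gt (hl : lam.IsRegular) {T : Set Ordinal.{u}} (hT : Stat lam T)
    (hTS : T ⊆ cofSet lam) {ε : Ordinal.{u}} (hε : ∀ δ ∈ T, ε < δ) :
    Stat lam {δ ∈ T | ∃ δ' ∈ T, δ < δ' ∧ ε < D.low δ' δ} := by
  intro F hF
  have hC := hT.inter_closed hF
  obtain ⟨H, hH, hH'⟩ := (hC.unb hl fun δ hδ => hTS hδ.1).exists_selfMap
  obtain ⟨δ', hδ', hδ'θ, hc⟩ := hC H hH
  obtain ⟨x, hx, hlow⟩ := D.low_gt (hTS hδ'.1) (hε δ' hδ'.1)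
  have h := hH' x (hx.trans hδ'θ)
  exact ⟨H x, ⟨h.1.1, δ', hδ'.1, hc x hx, hlow _ h.2 (hc x hx)⟩, h.1.2⟩

/-- For `δ` in the stationary set `T`, the signs of `α ∈ A` and `β δ` along the lower trace of
the walk from `β δ` to `δ` do not depend on `α` and `δ`. -/
structure Homog (D : Ladder lam) (A T : Set Ordinal.{u}) (β : Ordinal.{u} → Ordinal.{u})
    (w : List Bool) (η : Ordinal.{u}) : Prop where
  unb : Unb lam A
  sub : T ⊆ cofSet lam
  stat : Stat lam T
  le : ∀ δ ∈ T, δ ≤ β δ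
  lt : ∀ δ ∈ T, β δ < theta lam
  top_le : ∀ δ ∈ T, D.top 0 δ (β δ) ≤ η
  lt_of_mem : ∀ δ ∈ T, η < δ
  word_eq : ∀ δ ∈ T, ∀ α ∈ A, (D.lows 0 δ (β δ)).map (D.sign α (β δ)) = w

variable {D : Ladder lam}

theorem exists_press_rho (hl : lam.IsRegular) {T : Set Ordinal.{u}} (hT : Stat lam T)
    (hTS : T ⊆ cofSet lam) {β : Ordinal.{u} → Ordinal.{u}} (hle : ∀ δ ∈ T, δ ≤ β δ)
    (hlt : ∀ δ ∈ T, β δ < theta lam) {m : Ordinal.{u}} (hm : m < theta lam) :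
    ∃ T' ⊆ T, Stat lam T' ∧ ∃ ε, m ≤ ε ∧ ∀ δ ∈ T', ε < δ ∧
      ∀ ξ, ε < ξ → ξ < δ → D.rho ξ (β δ) = D.rho ξ δ := by
  have : ∀ δ, ∃ ε, δ ∈ T → ε < δ ∧ ∀ ξ, ε < ξ → ξ < δ → D.rho ξ (β δ) = D.rho ξ δ := by
    intro δ
    by_cases hδ : δ ∈ T
    · obtain ⟨ε, hε⟩ := D.rho_eventually_eq hl (hTS hδ) (hle δ hδ) (hlt δ hδ)
      exact ⟨ε, fun _ => hε⟩
    · exact ⟨0, fun h => absurd h hδ⟩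
  choose ε hε using this
  have hpos : ∀ δ ∈ T, 0 < δ := fun δ hδ => pos_of_mem_cofSet hl (hTS hδ)
  obtain ⟨e₀, -, he₀⟩ := (hT.inter_gt hpos hm).fodor hl (r := fun δ => max m (ε δ))
    (fun δ hδ => max_lt hδ.2 (hε δ hδ.1).1)
  obtain ⟨δ₀, hδ₀⟩ := he₀.nonempty
  refine ⟨_, fun δ hδ => hδ.1.1, he₀, e₀, hδ₀.2 ▸ le_max_left _ _, fun δ hδ => ?_⟩
  have h := hε δ hδ.1.1
  have hδ2 : max m (ε δ) = e₀ := hδ.2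
  rw [← hδ2]
  exact ⟨max_lt hδ.1.2 h.1, fun ξ hξ => h.2 ξ ((le_max_right _ _).trans_lt hξ)⟩

theorem exists_stretch (hl : lam.IsRegular) {T : Set Ordinal.{u}} (hT : Stat lam T)
    (hTS : T ⊆ cofSet lam) {β : Ordinal.{u} → Ordinal.{u}} (hle : ∀ δ ∈ T, δ ≤ β δ)
    (hlt : ∀ δ ∈ T, β δ < theta lam) {ε : Ordinal.{u}} (hε : ∀ δ ∈ T, ε < δ)
    (htop : ∀ δ ∈ T, D.top 0 δ (β δ) ≤ ε) :
    ∃ T' ⊆ T, Stat lam T' ∧ ∃ (σ : Ordinal.{u} → Ordinal.{u}) (L V : List Ordinal.{u})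
      (η : Ordinal.{u}), L ≠ [] ∧ (∀ ξ ∈ L, ε < ξ) ∧ ∀ δ ∈ T', σ δ ∈ T ∧ δ < σ δ ∧
        D.lows 0 δ (β (σ δ)) = D.lows 0 (σ δ) (β (σ δ)) ++ L ∧ (∀ ξ ∈ L, ξ < δ) ∧
        L.map (fun ξ => D.rho ξ (β (σ δ))) = V ∧ D.top 0 δ (β (σ δ)) ≤ η ∧ η < δ := by
  have hpos : ∀ δ ∈ T, 0 < δ := fun δ hδ => pos_of_mem_cofSet hl (hTS hδ)
  have h1 := (D.stat_low_gt hl hT hTS hε).inter_gt (fun δ hδ => hpos δ hδ.1)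
    (lt_theta_of_le_ord (le_refl lam.ord))
  have : ∀ δ, ∃ δ', (∃ δ' ∈ T, δ < δ' ∧ ε < D.low δ' δ) → δ' ∈ T ∧ δ < δ' ∧ ε < D.low δ' δ := by
    intro δ
    by_cases h : ∃ δ' ∈ T, δ < δ' ∧ ε < D.low δ' δ
    · obtain ⟨δ', h'⟩ := h
      exact ⟨δ', fun _ => h'⟩
    · exact ⟨0, fun h' => absurd h' h⟩
  choose σ hσ using this
  have hω : ∀ δ ∈ T, ω ≤ δ := fun δ hδ => omega_le_of_mem_cofSet hl (hTS hδ)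
  have htop' : ∀ δ ∈ {δ ∈ {δ ∈ T | ∃ δ' ∈ T, δ < δ' ∧ ε < D.low δ' δ} | lam.ord < δ},
      D.top 0 δ (β (σ δ)) < δ ∧ D.top 0 δ (σ δ) < δ := by
    intro δ hδ
    have h := hσ δ hδ.1.2
    exact ⟨D.top_lt (hTS hδ.1.1) (hlt _ h.1) (hpos δ hδ.1.1),
      D.top_lt (hTS hδ.1.1) (hTS h.1).1 (hpos δ hδ.1.1)⟩
  obtain ⟨L, h2⟩ := h1.press hl (fun δ hδ => hω δ hδ.1.1) (r := fun δ => D.lows 0 δ (σ δ))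
    (fun δ hδ x hx => (le_top_of_mem_lows hx).trans_lt (htop' δ hδ).2)
  obtain ⟨V, h3⟩ := h2.press hl (fun δ hδ => hω δ hδ.1.1.1)
    (r := fun δ => L.map (fun ξ => D.rho ξ (β (σ δ)))) (by
      intro δ hδ x hx
      obtain ⟨ξ, -, rfl⟩ := List.mem_map.1 hx
      exact (D.rho_lt hl (hlt _ (hσ δ hδ.1.1.2).1)).trans hδ.1.2)
  obtain ⟨η, -, h4⟩ := h3.fodor hl (r := fun δ => D.top 0 δ (β (σ δ)))
    (fun δ hδ => (htop' δ hδ.1.1).1)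
  obtain ⟨δ₀, hδ₀⟩ := h4.nonempty
  have hδ₀σ := hσ δ₀ hδ₀.1.1.1.1.2
  refine ⟨_, fun δ hδ => hδ.1.1.1.1.1, h4, σ, L, V, η, ?_, ?_, fun δ hδ => ?_⟩
  · rw [← hδ₀.1.1.2]
    simp [lows_of_lt hδ₀σ.2.1]
  · intro ξ hξ
    rw [← hδ₀.1.1.2] at hξ
    exact hδ₀σ.2.2.trans_le (low_le_of_mem_lows hξ)
  · obtain ⟨⟨⟨hδ1, hL⟩, hV⟩, hη⟩ := hδ
    have h := hσ δ hδ1.1.2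
    have hlow := (htop _ h.1).trans_lt h.2.2
    refine ⟨h.1, h.2.1, ?_, ?_, hV, hη.le, hη ▸ (htop' δ hδ1).1⟩
    · rw [(walk_concat (hle _ h.1) (hlow.trans_le (D.low_le h.2.1) ) h.2.1).2.1,
        lows_eq_zero h.2.1 hlow.le]
      rw [hL]
    · intro ξ hξ
      rw [← hL] at hξ
      exact (le_top_of_mem_lows hξ).trans_lt (htop' δ hδ1).2

/-- The common word of a homogeneous pair can be extended by a constant block. -/
theorem Homog.extend (hl : lam.IsRegular) (hl' : ℵ₀ < lam) {A T : Set Ordinal.{u}}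
    {β : Ordinal.{u} → Ordinal.{u}} {w : List Bool} {η : Ordinal.{u}}
    (h : Homog D A T β w η) (b : Bool) :
    ∃ (A' T' : Set Ordinal.{u}) (σ : Ordinal.{u} → Ordinal.{u}) (η' : Ordinal.{u}) (k : ℕ),
      A' ⊆ A ∧ T' ⊆ T ∧ 0 < k ∧ (∀ δ ∈ T', σ δ ∈ T ∧ δ < σ δ) ∧
      Homog D A' T' (fun δ => β (σ δ)) (w ++ List.replicate k b) η' := by
  obtain ⟨δ₀, hδ₀⟩ := h.stat.nonempty
  have hηθ : η < theta lam := (h.lt_of_mem δ₀ hδ₀).trans (h.sub hδ₀).1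
  have core : ∀ {T' : Set Ordinal.{u}} {σ : Ordinal.{u} → Ordinal.{u}}
      {L : List Ordinal.{u}} {η' : Ordinal.{u}} {A' : Set Ordinal.{u}}, T' ⊆ T → Stat lam T' →
      L ≠ [] → A' ⊆ A → Unb lam A' →
      (∀ δ ∈ T', σ δ ∈ T ∧ δ < σ δ ∧ D.lows 0 δ (β (σ δ)) = D.lows 0 (σ δ) (β (σ δ)) ++ L ∧
        D.top 0 δ (β (σ δ)) ≤ η' ∧ η' < δ) →
      (∀ δ ∈ T', ∀ α ∈ A', ∀ ξ ∈ L, D.sign α (β (σ δ)) ξ = b) →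
      ∃ (A' T' : Set Ordinal.{u}) (σ : Ordinal.{u} → Ordinal.{u}) (η' : Ordinal.{u}) (k : ℕ),
      A' ⊆ A ∧ T' ⊆ T ∧ 0 < k ∧ (∀ δ ∈ T', σ δ ∈ T ∧ δ < σ δ) ∧
        Homog D A' T' (fun δ => β (σ δ)) (w ++ List.replicate k b) η' := by
    intro T' σ L η' A' hT' hstat hL hA' hunb hσ hsign
    refine ⟨A', T', σ, η', L.length, hA', hT', List.length_pos_iff.2 hL,
      fun δ hδ => ⟨(hσ δ hδ).1, (hσ δ hδ).2.1⟩, hunb, hT'.trans h.sub, hstat,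
      fun δ hδ => (hσ δ hδ).2.1.le.trans (h.le _ (hσ δ hδ).1), fun δ hδ => h.lt _ (hσ δ hδ).1,
      fun δ hδ => (hσ δ hδ).2.2.2.1, fun δ hδ => (hσ δ hδ).2.2.2.2, fun δ hδ α hα => ?_⟩
    rw [(hσ δ hδ).2.2.1, List.map_append, h.word_eq _ (hσ δ hδ).1 α (hA' hα)]
    congr 1
    exact List.eq_replicate_iff.2 ⟨List.length_map _, fun c hc => by
      obtain ⟨ξ, hξ, rfl⟩ := List.mem_map.1 hc
      exact hsign δ hδ α hα ξ hξ⟩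
  cases b with
  | false =>
    obtain ⟨H, hH, hH'⟩ := h.unb.exists_selfMap
    obtain ⟨T₁, hT₁, hT₁s, ε₁, hηε₁, hε₁⟩ := exists_press_rho (D := D) hl h.stat h.sub h.le h.lt hηθ
    obtain ⟨δ₁, hδ₁⟩ := hT₁s.nonempty
    obtain ⟨T₂, hT₂, hT₂s, ε₂, hε₁₂, hε₂⟩ := exists_press_rho (D := D) (β := H) hl hT₁s
      (hT₁.trans h.sub) (fun δ hδ => (hH' δ (h.sub (hT₁ hδ)).1).2.le)
      (fun δ hδ => hH δ (h.sub (hT₁ hδ)).1) ((hε₁ δ₁ hδ₁).1.trans (h.sub (hT₁ hδ₁)).1)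
    obtain ⟨T₃, hT₃, hT₃s, σ, L, V, η', hL, hLε, hσ⟩ := exists_stretch (D := D) hl hT₂s
      ((hT₂.trans hT₁).trans h.sub) (fun δ hδ => h.le δ (hT₁ (hT₂ hδ)))
      (fun δ hδ => h.lt δ (hT₁ (hT₂ hδ))) (fun δ hδ => (hε₂ δ hδ).1)
      (fun δ hδ => (h.top_le δ (hT₁ (hT₂ hδ))).trans (hηε₁.trans hε₁₂))
    have hT₃T := hT₃.trans (hT₂.trans hT₁)
    have hσθ : ∀ δ ∈ T₃, σ δ < theta lam :=
      fun δ hδ => (h.sub (hT₁ (hT₂ (hσ δ hδ).1))).1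
    have hsubA : (fun δ => H (σ δ)) '' T₃ ⊆ A := by
      rintro _ ⟨δ, hδ, rfl⟩
      exact (hH' _ (hσθ δ hδ)).1
    refine core (σ := σ) (η' := η') hT₃T hT₃s hL hsubA ⟨hsubA.trans h.unb.1, fun ε hε => ?_⟩
      (fun δ hδ => ?_) ?_
    · obtain ⟨δ, hδ, hlt⟩ := (hT₃s.unb hl (hT₃T.trans h.sub)).2 ε hε
      exact ⟨_, ⟨δ, hδ, rfl⟩, hlt.trans ((hσ δ hδ).2.1.trans (hH' _ (hσθ δ hδ)).2)⟩
    · obtain ⟨h1, h2, h3, -, -, h4⟩ := hσ δ hδ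
      exact ⟨hT₁ (hT₂ h1), h2, h3, h4⟩
    · rintro δ hδ _ ⟨δ', hδ', rfl⟩ ξ hξ
      have hV := (hσ δ hδ).2.2.2.2.1.trans (hσ δ' hδ').2.2.2.2.1.symm
      have hρ := List.map_inj_left.1 hV ξ hξ
      have hξσ := ((hσ δ' hδ').2.2.2.1 ξ hξ).trans (hσ δ' hδ').2.1
      simp only [sign, decide_eq_false_iff_not, not_lt]
      rw [hρ, (hε₂ _ (hσ δ' hδ').1).2 ξ (hLε ξ hξ) hξσ,
        (hε₁ _ (hT₂ (hσ δ' hδ').1)).2 ξ (hε₁₂.trans_lt (hLε ξ hξ)) hξσ]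
  | true =>
    obtain ⟨e₀, he₀, hlarge⟩ := exists_rho_large (D := D) hl hl' h.unb
    obtain ⟨T₁, hT₁, hT₁s, ε, hmε, hε⟩ := exists_press_rho (D := D) hl h.stat h.sub h.le h.lt
      (max_lt hηθ he₀)
    obtain ⟨T₂, hT₂, hT₂s, σ, L, V, η', hL, hLε, hσ⟩ := exists_stretch (D := D) hl hT₁s
      (hT₁.trans h.sub) (fun δ hδ => h.le δ (hT₁ hδ))
      (fun δ hδ => h.lt δ (hT₁ hδ)) (fun δ hδ => (hε δ hδ).1)
      (fun δ hδ => (h.top_le δ (hT₁ hδ)).trans ((le_max_left _ _).trans hmε))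
    have hT₂T := hT₂.trans hT₁
    obtain ⟨δ₂, hδ₂⟩ := hT₂s.nonempty
    have hVlt : ∀ x ∈ V, x < lam.ord := by
      intro x hx
      rw [← (hσ δ₂ hδ₂).2.2.2.2.1] at hx
      obtain ⟨ξ, -, rfl⟩ := List.mem_map.1 hx
      exact D.rho_lt hl (h.lt _ (hT₁ (hσ δ₂ hδ₂).1))
    obtain ⟨ν, hν, hVν⟩ := exists_list_bound hl.ord_pos hVlt
    refine core (σ := σ) (η' := η') (A' := {α ∈ A | ∀ ξ ∈ L, ν < D.rho ξ α}) hT₂T hT₂s hL (fun α hα => hα.1)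
      ⟨fun α hα => h.unb.1 hα.1, fun b hb => ?_⟩ (fun δ hδ => ?_) ?_
    · obtain ⟨α, hα, hbα, hρ⟩ := hlarge L (fun ξ hξ => ⟨((le_max_right _ _).trans hmε).trans_lt
        (hLε ξ hξ), ((hσ δ₂ hδ₂).2.2.2.1 ξ hξ).trans (h.sub (hT₂T hδ₂)).1⟩) ν hν b hb
      exact ⟨α, ⟨hα, hρ⟩, hbα⟩
    · obtain ⟨h1, h2, h3, -, -, h4⟩ := hσ δ hδ
      exact ⟨hT₁ h1, h2, h3, h4⟩
    · intro δ hδ α hα ξ hξ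
      simp only [sign, decide_eq_true_eq]
      refine (hVν _ ?_).trans_lt (hα.2 ξ hξ)
      rw [← (hσ δ hδ).2.2.2.2.1]
      exact List.mem_map.2 ⟨ξ, hξ, rfl⟩

theorem Homog.word_eventually_eq (hl : lam.IsRegular) {A T : Set Ordinal.{u}}
    {β : Ordinal.{u} → Ordinal.{u}} {w : List Bool} {η : Ordinal.{u}}
    (h : Homog D A T β w η) {δ : Ordinal.{u}} (hδ : δ ∈ T) :
    ∃ ε < δ, ∀ α ∈ A, ε < α → α < δ →
      D.word α (β δ) = w ++ (D.lows 0 α δ).map (D.sign α δ) := by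
  obtain ⟨ε, hε, hρ⟩ := D.rho_eventually_eq hl (h.sub hδ) (h.le δ hδ) (h.lt δ hδ)
  have htop := (h.top_le δ hδ).trans_lt (h.lt_of_mem δ hδ)
  obtain ⟨x, hx, hlow⟩ := D.low_gt (h.sub hδ) (max_lt hε htop)
  refine ⟨x, hx, fun α hα hxα hαδ => ?_⟩
  have hlow := hlow α hxα hαδ
  have htl := (le_max_right _ _).trans_lt hlow
  rw [word, (walk_concat (h.le δ hδ) (htl.trans_le (D.low_le hαδ)) hαδ).2.1, List.map_append,
    h.word_eq δ hδ α hα, lows_eq_zero hαδ htl.le]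
  congr 1
  refine List.map_congr_left fun ξ hξ => ?_
  rw [sign, sign, hρ ξ (((le_max_left _ _).trans_lt hlow).trans_le (low_le_of_mem_lows hξ))
    ((le_max_of_mem_lows hξ).trans_lt (max_lt (zero_le.trans_lt hαδ) hαδ))]

theorem Homog.exists_osc_add (hl : lam.IsRegular) (hl' : ℵ₀ < lam)
    {V : Ordinal.{u} → Ordinal.{u} → Prop} (j : ℕ) {A T : Set Ordinal.{u}}
    {β : Ordinal.{u} → Ordinal.{u}} {w : List Bool} {η : Ordinal.{u}}
    (h : Homog D A T β w η) (hw : w.getLast? = some false)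
    (hV : ∀ δ ∈ T, ∃ ζ, δ ≤ ζ ∧ V ζ (β δ)) {ε : Ordinal.{u} → Ordinal.{u}}
    (hε : ∀ δ ∈ T, ε δ < δ) :
    ∃ δ ∈ T, ∃ α ∈ A, ε δ < α ∧ α < δ ∧
      ∀ m ≤ j, ∃ ζ β', V ζ β' ∧ α < ζ ∧ D.osc α β' = D.osc α (β δ) + m := by
  induction j generalizing A T β w η ε with
  | zero =>
    obtain ⟨H, hH, hH'⟩ := h.unb.exists_selfMap
    obtain ⟨δ, hδ, hδθ, hc⟩ := h.stat H hH
    have hm := hH' _ ((hε δ hδ).trans hδθ)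
    refine ⟨δ, hδ, _, hm.1, hm.2, hc _ (hε δ hδ), fun m hm' => ?_⟩
    obtain ⟨ζ, hζ, hVζ⟩ := hV δ hδ
    exact ⟨ζ, _, hVζ, (hc _ (hε δ hδ)).trans_le hζ, by simp [Nat.le_zero.1 hm']⟩
  | succ j ih =>
    obtain ⟨A₁, T₁, σ₁, η₁, k₁, hA₁, hT₁, hk₁, hσ₁, h₁⟩ := h.extend hl hl' true
    obtain ⟨A₂, T₂, σ₂, η₂, k₂, hA₂, hT₂, hk₂, hσ₂, h₂⟩ := h₁.extend hl hl' false
    have : ∀ δ, ∃ e, δ ∈ T₂ → e < δ ∧ ∀ α ∈ A₂, e < α → α < δ →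
        D.osc α (β (σ₁ (σ₂ δ))) = D.osc α (β δ) + 1 := by
      intro δ
      by_cases hδ : δ ∈ T₂
      · obtain ⟨e, he, h'⟩ := h.word_eventually_eq hl (hT₁ (hT₂ hδ))
        obtain ⟨e₂, he₂, h'₂⟩ := h₂.word_eventually_eq hl hδ
        refine ⟨max e e₂, fun _ => ⟨max_lt he he₂, fun α hα hlt hαδ => ?_⟩⟩
        have hd : List.getLast? (List.replicate k₁ true ++ List.replicate k₂ false)
            = some false := by
          simp [List.getLast?_append, List.getLast?_replicate, hk₂.ne']
        rw [osc, osc, h' α (hA₁ (hA₂ hα)) ((le_max_left _ _).trans_lt hlt) hαδ,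
          h'₂ α hα ((le_max_right _ _).trans_lt hlt) hαδ, List.append_assoc, List.append_assoc,
          descents_append hw, descents_append hw, ← List.append_assoc, descents_append hd,
          descents_true_false hk₁ hk₂]
        omega
      · exact ⟨0, fun h => absurd h hδ⟩
    choose e he using this
    obtain ⟨δ, hδ, α, hα, hεα, hαδ, hosc⟩ := ih h₂
      (by simp [List.getLast?_append, List.getLast?_replicate, hk₂.ne'])
      (fun δ hδ => by
        obtain ⟨ζ, hζ, hVζ⟩ := hV _ (hσ₁ _ (hσ₂ δ hδ).1).1
        exact ⟨ζ, ((hσ₂ δ hδ).2.trans (hσ₁ _ (hσ₂ δ hδ).1).2).le.trans hζ, hVζ⟩)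
      (ε := fun δ => max (ε δ) (e δ)) (fun δ hδ => max_lt (hε δ (hT₁ (hT₂ hδ))) (he δ hδ).1)
    refine ⟨δ, hT₁ (hT₂ hδ), α, hA₁ (hA₂ hα), (le_max_left _ _).trans_lt hεα, hαδ, fun m hm => ?_⟩
    cases m with
    | zero =>
      obtain ⟨ζ, hζ, hVζ⟩ := hV δ (hT₁ (hT₂ hδ))
      exact ⟨ζ, _, hVζ, hαδ.trans_le hζ, rfl⟩
    | succ m =>
      obtain ⟨ζ, β', hVζ, hαζ, h'⟩ := hosc m (by omega)
      refine ⟨ζ, β', hVζ, hαζ, ?_⟩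
      rw [h', (he δ hδ).2 α hα ((le_max_right _ _).trans_lt hεα) hαδ]
      omega

end Ladder

theorem exists_padicValNat_eq (n p : ℕ) : ∃ m ≤ 2 ^ (p + 1), padicValNat 2 (n + m) = p := by
  have hval : ∀ q, padicValNat 2 (2 ^ p * (2 * q + 1)) = p := by
    intro q
    rw [padicValNat.mul (by positivity) (by omega), padicValNat.prime_pow,
      padicValNat.eq_zero_of_not_dvd (by omega), add_zero]
  have hmod := Nat.div_add_mod n (2 ^ (p + 1))
  have hlt := Nat.mod_lt n (show 2 ^ (p + 1) > 0 by positivity)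
  set r := n / 2 ^ (p + 1)
  have h1 : 2 ^ p * (2 * r + 1) = 2 ^ (p + 1) * r + 2 ^ p := by ring
  have h2 : 2 ^ p * (2 * (r + 1) + 1) = 2 ^ (p + 1) * r + 2 ^ p + 2 ^ (p + 1) := by ring
  have hp : 2 ^ p ≤ 2 ^ (p + 1) := Nat.pow_le_pow_right (by norm_num) (by omega)
  rcases le_or_gt n (2 ^ (p + 1) * r + 2 ^ p) with h | h
  · refine ⟨2 ^ (p + 1) * r + 2 ^ p - n, by omega, ?_⟩
    rw [Nat.add_sub_cancel' h, ← h1, hval]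
  · refine ⟨2 ^ (p + 1) * r + 2 ^ p + 2 ^ (p + 1) - n, by omega, ?_⟩
    rw [Nat.add_sub_cancel' (by omega), ← h2, hval]

namespace Ladder
variable {D : Ladder lam}

theorem exists_homog (hl : lam.IsRegular) {A B T : Set Ordinal.{u}} (hA : Unb lam A)
    (hB : Unb lam B) (hT : Stat lam T) (hTS : T ⊆ cofSet lam) :
    ∃ A' ⊆ A, ∃ T' ⊆ T, ∃ β w η, Homog D A' T' β w η ∧ ∀ δ ∈ T', β δ ∈ B := by
  obtain ⟨a, ha, ha'⟩ := hA.exists_selfMap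
  obtain ⟨β, hβ, hβ'⟩ := hB.exists_selfMap
  have hpos : ∀ δ ∈ T, 0 < δ := fun δ hδ => pos_of_mem_cofSet hl (hTS hδ)
  have hω : ∀ δ ∈ T, ω ≤ δ := fun δ hδ => omega_le_of_mem_cofSet hl (hTS hδ)
  have htop : ∀ δ ∈ T, D.top 0 δ (β δ) < δ :=
    fun δ hδ => top_lt (hTS hδ) (hβ δ (hTS hδ).1) (hpos δ hδ)
  obtain ⟨η, -, h1⟩ := (hT.inter_gt hpos (lt_theta_of_le_ord (le_refl lam.ord))).fodor hl
    (r := fun δ => D.top 0 δ (β δ)) (fun δ hδ => htop δ hδ.1)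
  obtain ⟨L, h2⟩ := h1.press hl (fun δ hδ => hω δ hδ.1.1) (r := fun δ => D.lows 0 δ (β δ))
    (fun δ hδ x hx => (le_top_of_mem_lows hx).trans_lt (htop δ hδ.1.1))
  obtain ⟨V, h3⟩ := h2.press hl (fun δ hδ => hω δ hδ.1.1.1)
    (r := fun δ => L.map (fun ξ => D.rho ξ (β δ))) (by
      intro δ hδ x hx
      obtain ⟨ξ, -, rfl⟩ := List.mem_map.1 hx
      exact (D.rho_lt hl (hβ δ (hTS hδ.1.1.1).1)).trans hδ.1.1.2)
  obtain ⟨W, h4⟩ := h3.press hl (fun δ hδ => hω δ hδ.1.1.1.1)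
    (r := fun δ => L.map (fun ξ => D.rho ξ (a δ))) (by
      intro δ hδ x hx
      obtain ⟨ξ, -, rfl⟩ := List.mem_map.1 hx
      exact (D.rho_lt hl (ha δ (hTS hδ.1.1.1.1).1)).trans hδ.1.1.1.2)
  set T' : Set Ordinal.{u} := {δ ∈ {δ ∈ {δ ∈ {δ ∈ {δ ∈ T | lam.ord < δ} |
    D.top 0 δ (β δ) = η} | D.lows 0 δ (β δ) = L} |
    L.map (fun ξ => D.rho ξ (β δ)) = V} | L.map (fun ξ => D.rho ξ (a δ)) = W}
  have hsub : T' ⊆ T := fun δ hδ => hδ.1.1.1.1.1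
  have hθ : ∀ δ ∈ T', δ < theta lam := fun δ hδ => (hTS (hsub hδ)).1
  obtain ⟨e, he⟩ := h4.nonempty
  have haA : a '' T' ⊆ A := by
    rintro _ ⟨δ, hδ, rfl⟩
    exact (ha' δ (hθ δ hδ)).1
  refine ⟨a '' T', haA, T', hsub, β, L.map (D.sign (a e) (β e)), η,
    ⟨⟨haA.trans hA.1, fun b hb => ?_⟩, hsub.trans hTS, h4, fun δ hδ => (hβ' δ (hθ δ hδ)).2.le,
      fun δ hδ => hβ δ (hθ δ hδ), fun δ hδ => hδ.1.1.1.2.le,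
      fun δ hδ => hδ.1.1.1.2 ▸ htop δ (hsub hδ), ?_⟩, fun δ hδ => (hβ' δ (hθ δ hδ)).1⟩
  · obtain ⟨δ, hδ, hlt⟩ := (h4.unb hl (hsub.trans hTS)).2 b hb
    exact ⟨_, ⟨δ, hδ, rfl⟩, hlt.trans (ha' δ (hθ δ hδ)).2⟩
  · rintro δ hδ _ ⟨δ', hδ', rfl⟩
    rw [show D.lows 0 δ (β δ) = L from hδ.1.1.2]
    refine List.map_congr_left fun ξ hξ => ?_
    rw [sign, sign, List.map_inj_left.1 (hδ.1.2.trans he.1.2.symm) ξ hξ,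
      List.map_inj_left.1 (hδ'.2.trans he.2.symm) ξ hξ]

end Ladder

/-- `lam⁺ ↛ [lam⁺; lam⁺]²` with `lam⁺` colours, for regular uncountable `lam`. -/
theorem exists_coloring (hl : lam.IsRegular) (hl' : ℵ₀ < lam) :
    ∃ d : Ordinal.{u} → Ordinal.{u} → Ordinal.{u}, (∀ a b, d a b < theta lam) ∧
      ∀ A B : Set Ordinal.{u}, Unb lam A → Unb lam B → ∀ ς < theta lam,
        ∃ α ∈ A, ∃ β ∈ B, α < β ∧ d α β = ς := by
  obtain ⟨D⟩ := exists_ladder hl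
  obtain ⟨h, hh, hstat⟩ := exists_splitting hl hl'
  refine ⟨fun α β => h ((D.tr α β).getD (padicValNat 2 (D.osc α β + 1)) 0), fun _ _ => hh _, ?_⟩
  intro A B hA hB ς hς
  obtain ⟨A₁, hA₁, T₁, hT₁, β, w, η, h₁, hβ⟩ :=
    Ladder.exists_homog (D := D) hl hA hB (hstat ς hς) fun δ hδ => hδ.1
  obtain ⟨A₂, T₂, σ, η₂, k, hA₂, hT₂, hk, hσ, h₂⟩ := h₁.extend hl hl' false
  obtain ⟨δ, -, α, hα, hηα, -, hosc⟩ := h₂.exists_osc_add hl hl'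
    (V := fun ζ β' => ζ ∈ T₁ ∧ β' = β ζ) (2 ^ (w.length + 1))
    (by simp [List.getLast?_append, List.getLast?_replicate, hk.ne'])
    (fun δ hδ => ⟨σ δ, (hσ δ hδ).2.le, (hσ δ hδ).1, rfl⟩) (ε := fun _ => η)
    (fun δ hδ => h₁.lt_of_mem δ (hT₂ hδ))
  obtain ⟨m, hm, hval⟩ := exists_padicValNat_eq (D.osc α (β (σ δ)) + 1) w.length
  obtain ⟨ζ, _, ⟨hζ, rfl⟩, hαζ, heq⟩ := hosc m hm
  refine ⟨α, hA₁ (hA₂ hα), β ζ, hβ ζ hζ, hαζ.trans_le (h₁.le ζ hζ), ?_⟩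
  have hlen : (D.tr ζ (β ζ)).length = w.length := by
    rw [← Ladder.length_lows (m := 0), ← h₁.word_eq ζ hζ α (hA₂ hα), List.length_map]
  have htr := (Ladder.walk_concat (D := D) (m := 0) (h₁.le ζ hζ)
    ((h₁.top_le ζ hζ).trans_lt hηα) hαζ).1
  simp only
  rw [heq, add_right_comm, hval, htr, Ladder.tr_of_lt hαζ, ← hlen,
    List.getD_append_right _ _ _ _ le_rfl, Nat.sub_self, List.getD_cons_zero]
  exact (hT₁ hζ).2

theorem unb_of_unbddIn (hl : lam.IsRegular) {A : Set Ordinal.{u}} (hA : A ⊆ Iio (theta lam))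
    (h : UnbddIn A (theta lam)) : Unb lam A := by
  refine ⟨hA, fun ε hε => ?_⟩
  obtain ⟨y, hy, hle, -⟩ := h _ (succ_lt_theta hl hε)
  exact ⟨y, hy, Order.add_one_le_iff.1 hle⟩

end StrongColoring

/-- For every infinite regular `κ` there is a coloring `d : [κ⁺⁺]² → κ⁺⁺` realizing every color
`ς < κ⁺⁺` on some pair `α < β` with `α ∈ A`, `β ∈ B`, for all unbounded `A, B ⊆ κ⁺⁺`. -/
theorem stmt8 (κ : Cardinal) (hκ : κ.IsRegular) :
    ∃ d : Ordinal → Ordinal → Ordinal,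
      (∀ a b, a < b → b < (Order.succ (Order.succ κ)).ord →
        d a b < (Order.succ (Order.succ κ)).ord) ∧
      ∀ A B : Set Ordinal,
        A ⊆ Set.Iio ((Order.succ (Order.succ κ)).ord) →
        B ⊆ Set.Iio ((Order.succ (Order.succ κ)).ord) →
        UnbddIn A ((Order.succ (Order.succ κ)).ord) →
        UnbddIn B ((Order.succ (Order.succ κ)).ord) →
        ∀ ς, ς < (Order.succ (Order.succ κ)).ord →
          ∃ α ∈ A, ∃ β ∈ B, α < β ∧ d α β = ς := by
  have hl : (Order.succ κ).IsRegular := Cardinal.isRegular_succ hκ.aleph0_le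
  obtain ⟨d, hd, h⟩ :=
    StrongColoring.exists_coloring hl (hκ.aleph0_le.trans_lt (Order.lt_succ κ))
  exact ⟨d, fun a b _ _ => hd a b, fun A B hA hB hA' hB' => h A B
    (StrongColoring.unb_of_unbddIn hl hA hA') (StrongColoring.unb_of_unbddIn hl hB hB')⟩

end
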